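/- arXiv:1612.06240 — 4 statements merged into one kernel-verified Lean document; each statement's English description precedes it below -/
import Mathlib

section
/- For all natural numbers r₁, s₁, t₁, r₂, s₂, t₂ one has the normal-ordering product formula (b^r₁ * a^s₁ * c^t₁) * (b^r₂ * a^s₂ * c^t₂) = Σ_{n=0}^{min s₁ r₂} (n! * (s₁ choose n) * (r₂ choose n)) • (b^(r₁+r₂−n) * a^(s₁+s₂−n) * c^(t₁+t₂+n)); here the natural-number coefficient n!·C(s₁,n)·C(r₂,n) equals s₁! r₂! / ((s₁−n)! n! (r₂−n)!), recovering the classical normal-ordering coefficients of the Heisenberg–Weyl diagram algebra. -/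
/-- If `[a, b] = c` commutes with `b`, then `a` acts on powers of `b` as a derivation. -/
theorem mul_pow_eq_pow_mul_add_smul {R : Type*} [Ring R] {a b c : R}
    (hab : a * b = b * a + c) (hbc : Commute b c) (r : ℕ) :
    a * b ^ r = b ^ r * a + r • (b ^ (r - 1) * c) := by
  induction r with
  | zero => simp
  | succ r ih =>
    have hpow : r • (b ^ (r - 1) * c) * b = r • (b ^ r * c) := by
      cases r with
      | zero => simp
      | succ k => simp only [smul_mul_assoc, mul_assoc, ← hbc.eq, pow_succ, Nat.add_sub_cancel]
    rw [pow_succ, ← mul_assoc, ih, add_mul, hpow, mul_assoc, hab, mul_add, ← mul_assoc, add_assoc,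
      Nat.add_sub_cancel, succ_nsmul']

/-- The recursion for the normal-ordering coefficients `n! * s.choose n * r.choose n`. -/
theorem factorial_mul_choose_mul_choose_succ (s r n : ℕ) :
    (n + 1).factorial * (s + 1).choose (n + 1) * r.choose (n + 1) =
      (n + 1).factorial * s.choose (n + 1) * r.choose (n + 1) +
        n.factorial * s.choose n * r.choose n * (r - n) := by
  rw [mul_assoc _ (r.choose n), ← Nat.choose_succ_right_eq, Nat.choose_succ_succ',
    Nat.factorial_succ]
  ring

/-- Normal ordering of `a ^ s * b ^ r` when `[a, b] = c` commutes with `a` and `b`. -/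
theorem pow_mul_pow_eq_sum_normal_ordering {R : Type*} [Ring R] {a b c : R}
    (hab : a * b = b * a + c) (hac : Commute a c) (hbc : Commute b c) (s r : ℕ) :
    a ^ s * b ^ r = ∑ n ∈ Finset.range (s + 1),
      (n.factorial * s.choose n * r.choose n) • (b ^ (r - n) * a ^ (s - n) * c ^ n) := by
  induction s with
  | zero => simp
  | succ s ih =>
    have hterm (n : ℕ) (hn : n ∈ Finset.range (s + 1)) :
        a * ((n.factorial * s.choose n * r.choose n) • (b ^ (r - n) * a ^ (s - n) * c ^ n)) =
          (n.factorial * s.choose n * r.choose n) • (b ^ (r - n) * a ^ (s + 1 - n) * c ^ n) +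
          (n.factorial * s.choose n * r.choose n * (r - n)) •
            (b ^ (r - (n + 1)) * a ^ (s + 1 - (n + 1)) * c ^ (n + 1)) := by
      have hs : s + 1 - n = (s - n) + 1 := by
        have := Finset.mem_range.mp hn
        omega
      have hc : c * (a ^ (s - n) * c ^ n) = a ^ (s - n) * c ^ (n + 1) := by
        rw [← mul_assoc, ← (hac.pow_left _).eq, mul_assoc, ← pow_succ']
      rw [mul_smul_comm, mul_assoc (b ^ _), ← mul_assoc a, mul_pow_eq_pow_mul_add_smul hab hbc,
        add_mul, smul_mul_assoc, mul_assoc _ c, hc, smul_add, smul_smul, hs, pow_succ' a,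
        Nat.add_sub_add_right, Nat.sub_sub]
      simp only [mul_assoc]
    rw [pow_succ', mul_assoc, ih, Finset.mul_sum, Finset.sum_congr rfl hterm,
      Finset.sum_add_distrib, Finset.sum_range_succ' _ (s + 1)]
    simp only [factorial_mul_choose_mul_choose_succ, add_smul, Finset.sum_add_distrib]
    rw [add_right_comm]
    congr 1
    rw [Finset.sum_range_succ', Finset.sum_range_succ _ s]
    simp


/-- The normal-ordering product formula for the Heisenberg–Weyl diagram algebra:
for elements `a`, `b`, `c` of a ring with `[a,b] = c` and `c` central among `a, b`. -/
theorem hw_diagram_normal_ordering {R : Type*} [Ring R] (a b c : R)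
    (hab : a * b = b * a + c) (hac : a * c = c * a) (hbc : b * c = c * b)
    (r₁ s₁ t₁ r₂ s₂ t₂ : ℕ) :
    (b ^ r₁ * a ^ s₁ * c ^ t₁) * (b ^ r₂ * a ^ s₂ * c ^ t₂) =
      ∑ n ∈ Finset.range (min s₁ r₂ + 1),
        (n.factorial * s₁.choose n * r₂.choose n) •
          (b ^ (r₁ + r₂ - n) * a ^ (s₁ + s₂ - n) * c ^ (t₁ + t₂ + n)) := by
  have hac' : Commute a c := hac
  have hbc' : Commute b c := hbc
  have hmove : (b ^ r₁ * a ^ s₁ * c ^ t₁) * (b ^ r₂ * a ^ s₂ * c ^ t₂) =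
      b ^ r₁ * (a ^ s₁ * b ^ r₂) * (a ^ s₂ * c ^ (t₁ + t₂)) := by
    have hc : Commute (c ^ t₁) (b ^ r₂ * a ^ s₂) :=
      ((hbc'.pow_pow _ _).mul_left (hac'.pow_pow _ _)).symm
    rw [mul_assoc _ (c ^ t₁), ← mul_assoc (c ^ t₁), hc.eq, pow_add]
    simp only [mul_assoc]
  have hsub : Finset.range (min s₁ r₂ + 1) ⊆ Finset.range (s₁ + 1) :=
    Finset.range_subset_range.mpr (by omega)
  rw [hmove, pow_mul_pow_eq_sum_normal_ordering hab hac' hbc', Finset.mul_sum, Finset.sum_mul,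
    ← Finset.sum_subset hsub]
  · refine Finset.sum_congr rfl fun n hn => ?_
    have hn' := Finset.mem_range.mp hn
    have hr : r₁ + r₂ - n = r₁ + (r₂ - n) := by omega
    have hs : s₁ + s₂ - n = (s₁ - n) + s₂ := by omega
    have hc : c ^ n * (a ^ s₂ * c ^ (t₁ + t₂)) = a ^ s₂ * c ^ (t₁ + t₂ + n) := by
      rw [← mul_assoc, ← (hac'.pow_pow _ _).eq, mul_assoc, ← pow_add, add_comm n]
    rw [mul_smul_comm, smul_mul_assoc, hr, hs, pow_add b, pow_add a]
    simp only [mul_assoc, hc]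
  · intro n hn hn'
    rw [Finset.mem_range] at hn hn'
    rw [Nat.choose_eq_zero_of_lt (show r₂ < n by omega)]
    simp
end

section
/- For all natural numbers s and r one has a^s * b^r = Σ_{k=0}^{min s r} (k! * (s choose k) * (r choose k)) • (b^(r−k) * a^(s−k) * c^k). -/
/-- If `c = [a, b]` commutes with `b`, then `[a, b ^ n] = n • (b ^ (n - 1) * c)`. -/
theorem mul_pow_eq_pow_mul_add_nsmul {R : Type*} [Ring R] {a b c : R}
    (hab : a * b = b * a + c) (hbc : b * c = c * b) (n : ℕ) :
    a * b ^ n = b ^ n * a + n • (b ^ (n - 1) * c) := by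
  induction n with
  | zero => simp
  | succ n ih =>
    have hpow : n • (b ^ (n - 1) * c * b) = n • (b ^ n * c) := by
      rcases n with _ | n
      · simp
      · rw [mul_assoc, ← hbc, ← mul_assoc, Nat.add_sub_cancel, ← pow_succ]
    rw [pow_succ, ← mul_assoc, ih, add_mul, smul_mul_assoc, hpow, mul_assoc, hab, mul_add,
      Nat.add_sub_cancel, succ_nsmul, ← mul_assoc]
    abel

/-- Normal ordering of `a ^ s * b ^ r`, summed up to `s`: the terms with `r < k` vanish. -/
theorem pow_mul_pow_eq_sum_range_succ {R : Type*} [Ring R] {a b c : R}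
    (hab : a * b = b * a + c) (hac : a * c = c * a) (hbc : b * c = c * b) (s r : ℕ) :
    a ^ s * b ^ r =
      ∑ k ∈ Finset.range (s + 1),
        (k.factorial * s.choose k * r.choose k) • (b ^ (r - k) * a ^ (s - k) * c ^ k) := by
  induction s with
  | zero => simp
  | succ s ih =>
    have hterm : ∀ k ∈ Finset.range (s + 1),
        a * ((k.factorial * s.choose k * r.choose k) • (b ^ (r - k) * a ^ (s - k) * c ^ k)) =
          (k.factorial * s.choose k * r.choose k) • (b ^ (r - k) * a ^ (s + 1 - k) * c ^ k) +
          ((k + 1).factorial * s.choose k * r.choose (k + 1)) •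
            (b ^ (r - (k + 1)) * a ^ (s + 1 - (k + 1)) * c ^ (k + 1)) := by
      intro k hk
      have hks : s + 1 - k = (s - k) + 1 := by
        have := Finset.mem_range.mp hk
        omega
      have hcoef : (k + 1).factorial * s.choose k * r.choose (k + 1) =
          k.factorial * s.choose k * r.choose k * (r - k) := by
        rw [Nat.factorial_succ]
        linear_combination (k.factorial * s.choose k) * Nat.choose_succ_right_eq r k
      have hca : c * a ^ (s - k) = a ^ (s - k) * c :=
        (Commute.pow_left (show Commute a c from hac) _).eq.symm
      rw [mul_smul_comm, hcoef, mul_smul _ (r - k), ← smul_add, hks, Nat.add_sub_add_right, ← mul_assoc,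
        ← mul_assoc, mul_pow_eq_pow_mul_add_nsmul hab hbc, add_mul, add_mul, smul_mul_assoc,
        smul_mul_assoc, pow_succ' a, pow_succ' c, Nat.sub_sub, mul_assoc _ c, hca]
      simp only [mul_assoc]
    rw [pow_succ', mul_assoc, ih, Finset.mul_sum, Finset.sum_congr rfl hterm,
      Finset.sum_add_distrib, Finset.sum_range_succ' _ (s + 1)]
    have hextend := Finset.sum_range_succ
      (fun k => (k.factorial * s.choose k * r.choose k) •
        (b ^ (r - k) * a ^ (s + 1 - k) * c ^ k)) (s + 1)
    rw [Nat.choose_succ_self, mul_zero, zero_mul, zero_smul, add_zero,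
      Finset.sum_range_succ'] at hextend
    rw [← hextend, add_right_comm, ← Finset.sum_add_distrib, Nat.choose_zero_right,
      Nat.choose_zero_right]
    congr 1
    refine Finset.sum_congr rfl fun k _ => ?_
    rw [← add_smul, Nat.choose_succ_succ' s k]
    congr 1
    ring

/-- Normal ordering of `a ^ s * b ^ r` in a ring with `[a,b] = c` and `c` central
among `a, b`. -/
theorem hw_pow_mul_pow_normal_order {R : Type*} [Ring R] (a b c : R)
    (hab : a * b = b * a + c) (hac : a * c = c * a) (hbc : b * c = c * b)
    (s r : ℕ) :
    a ^ s * b ^ r =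
      ∑ k ∈ Finset.range (min s r + 1),
        (k.factorial * s.choose k * r.choose k) •
          (b ^ (r - k) * a ^ (s - k) * c ^ k) := by
  rw [pow_mul_pow_eq_sum_range_succ hab hac hbc]
  symm
  apply Finset.sum_subset
  · intro k hk
    simp only [Finset.mem_range] at hk ⊢
    omega
  · intro k hk hk'
    simp only [Finset.mem_range] at hk hk'
    rw [Nat.choose_eq_zero_of_lt (show r < k by omega), mul_zero, zero_smul]
end

section
/- For all natural numbers m₁, n₁, m₂, n₂ one has the Heisenberg–Weyl normal-ordering formula (b^m₁ * a^n₁) * (b^m₂ * a^n₂) = Σ_{p=0}^{min n₁ m₂} (p! * (n₁ choose p) * (m₂ choose p)) • (b^(m₁+m₂−p) * a^(n₁+n₂−p)), i.e. the composition of two normal-ordered expressions of the Heisenberg–Weyl (rule) algebra has the classical normal-ordering coefficients p!·C(n₁,p)·C(m₂,p). -/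
theorem mul_pow_of_mul_eq_mul_add_one {R : Type*} [Ring R] {a b : R}
    (hab : a * b = b * a + 1) (k : ℕ) :
    a * b ^ k = b ^ k * a + k • b ^ (k - 1) := by
  induction k with
  | zero => simp
  | succ k ih =>
    have h : k • (b ^ (k - 1) * b) = k • b ^ k := by
      cases k with
      | zero => simp
      | succ k => rw [Nat.add_sub_cancel, pow_succ]
    rw [pow_succ, ← mul_assoc, ih, add_mul, mul_assoc, hab, smul_mul_assoc, h, mul_add,
      mul_one, Nat.add_sub_cancel, succ_nsmul', mul_assoc, add_assoc]

theorem pow_mul_pow_of_mul_eq_mul_add_one {R : Type*} [Ring R] {a b : R}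
    (hab : a * b = b * a + 1) (n m : ℕ) :
    a ^ n * b ^ m = ∑ p ∈ Finset.range (n + 1),
      (n.choose p * m.descFactorial p) • (b ^ (m - p) * a ^ (n - p)) := by
  induction n with
  | zero => simp
  | succ n ih =>
    have hterm : ∀ p ∈ Finset.range (n + 1),
        a * ((n.choose p * m.descFactorial p) • (b ^ (m - p) * a ^ (n - p))) =
          (n.choose p * m.descFactorial p) • (b ^ (m - p) * a ^ (n + 1 - p)) +
          (n.choose p * m.descFactorial (p + 1)) •
            (b ^ (m - (p + 1)) * a ^ (n + 1 - (p + 1))) := by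
      intro p hp
      have hpn : n + 1 - p = (n - p) + 1 := by
        have := Finset.mem_range.mp hp
        omega
      rw [mul_smul_comm, ← mul_assoc, mul_pow_of_mul_eq_mul_add_one hab, add_mul, smul_add,
        hpn, pow_succ' a, mul_assoc, smul_mul_assoc, smul_smul, Nat.descFactorial_succ,
        Nat.add_sub_add_right, Nat.sub_sub, mul_assoc, mul_comm (m.descFactorial p)]
    have hshift : ∑ p ∈ Finset.range (n + 1),
          (n.choose p * m.descFactorial p) • (b ^ (m - p) * a ^ (n + 1 - p)) =
        ∑ p ∈ Finset.range (n + 2),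
          (n.choose p * m.descFactorial p) • (b ^ (m - p) * a ^ (n + 1 - p)) := by
      rw [Finset.sum_range_succ _ (n + 1)]
      simp
    rw [pow_succ', mul_assoc, ih, Finset.mul_sum, Finset.sum_congr rfl hterm,
      Finset.sum_add_distrib, hshift, Finset.sum_range_succ' _ (n + 1),
      Finset.sum_range_succ' _ (n + 1), add_right_comm, ← Finset.sum_add_distrib]
    congr 1
    · refine Finset.sum_congr rfl fun p _ => ?_
      rw [← add_smul, ← add_mul, Nat.choose_succ_succ, add_comm (n.choose p)]
    · simp

/-- The classical Heisenberg–Weyl normal-ordering formula for the composition of two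
normal-ordered expressions, in a ring with `a * b = b * a + 1`. -/
theorem hw_normal_ordering {R : Type*} [Ring R] (a b : R)
    (hab : a * b = b * a + 1)
    (m₁ n₁ m₂ n₂ : ℕ) :
    (b ^ m₁ * a ^ n₁) * (b ^ m₂ * a ^ n₂) =
      ∑ p ∈ Finset.range (min n₁ m₂ + 1),
        (p.factorial * n₁.choose p * m₂.choose p) •
          (b ^ (m₁ + m₂ - p) * a ^ (n₁ + n₂ - p)) := by
  have hassoc : (b ^ m₁ * a ^ n₁) * (b ^ m₂ * a ^ n₂) =
      b ^ m₁ * (a ^ n₁ * b ^ m₂) * a ^ n₂ := by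
    simp only [mul_assoc]
  rw [hassoc, pow_mul_pow_of_mul_eq_mul_add_one hab, Finset.mul_sum, Finset.sum_mul]
  symm
  refine Finset.sum_subset_zero_on_sdiff
    (Finset.range_subset_range.mpr (Nat.succ_le_succ (min_le_left _ _))) ?_ ?_
  · intro p hp
    simp only [Finset.mem_sdiff, Finset.mem_range] at hp
    have hlt : m₂ < p := by omega
    simp [Nat.descFactorial_of_lt hlt]
  · intro p hp
    have hp' := Finset.mem_range.mp hp
    have hm : m₁ + m₂ - p = m₁ + (m₂ - p) := by omega
    have hn : n₁ + n₂ - p = (n₁ - p) + n₂ := by omega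
    have hc : p.factorial * n₁.choose p * m₂.choose p =
        n₁.choose p * m₂.descFactorial p := by
      rw [Nat.descFactorial_eq_factorial_mul_choose]
      ring
    rw [hm, hn, hc, pow_add, pow_add, mul_smul_comm, smul_mul_assoc]
    simp only [mul_assoc]
end

section
/- If the R-subalgebra of A generated by the set of primitive elements is all of A (i.e. Algebra.adjoin R {x : A | Δ x = x ⊗ₜ 1 + 1 ⊗ₜ x} = ⊤), then the antipode of A is an involution: S (S a) = a for every a ∈ A. -/
open TensorProduct

/-- The counit of a primitive element vanishes after mapping back into the algebra. -/
theorem algebraMap_counit_eq_zero_of_primitive {R A : Type*} [CommRing R] [Ring A]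
    [Bialgebra R A] {x : A}
    (hx : Coalgebra.comul (R := R) x = x ⊗ₜ[R] (1 : A) + (1 : A) ⊗ₜ[R] x) :
    algebraMap R A (Coalgebra.counit (R := R) x) = 0 := by
  have h := congrArg (TensorProduct.lid R A) (Coalgebra.rTensor_counit_comul (R := R) x)
  simpa [hx, Algebra.algebraMap_eq_smul_one] using h

/-- The antipode negates primitive elements. -/
theorem antipode_eq_neg_of_primitive {R A : Type*} [CommRing R] [Ring A]
    [HopfAlgebra R A] {x : A}
    (hx : Coalgebra.comul (R := R) x = x ⊗ₜ[R] (1 : A) + (1 : A) ⊗ₜ[R] x) :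
    HopfAlgebra.antipode (R := R) x = -x := by
  have h := HopfAlgebra.mul_antipode_rTensor_comul_apply (R := R) x
  rw [algebraMap_counit_eq_zero_of_primitive hx, hx] at h
  exact eq_neg_of_add_eq_zero_left (by simpa using h)

/-- If a Hopf algebra is generated (as an algebra) by its primitive elements, then
its antipode is an involution. -/
theorem antipode_involutive_of_adjoin_primitives {R A : Type*} [CommRing R] [Ring A]
    [HopfAlgebra R A]
    (h : Algebra.adjoin R
        {x : A | Coalgebra.comul (R := R) x = x ⊗ₜ[R] (1 : A) + (1 : A) ⊗ₜ[R] x} = ⊤) :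
    ∀ a : A, HopfAlgebra.antipode (R := R) (HopfAlgebra.antipode (R := R) a) = a := by
  intro a
  have ha : a ∈ Algebra.adjoin R
      {x : A | Coalgebra.comul (R := R) x = x ⊗ₜ[R] (1 : A) + (1 : A) ⊗ₜ[R] x} :=
    h ▸ Algebra.mem_top
  induction ha using Algebra.adjoin_induction with
  | mem x hx => rw [antipode_eq_neg_of_primitive hx, map_neg, antipode_eq_neg_of_primitive hx,
      neg_neg]
  | algebraMap r => simp [Algebra.algebraMap_eq_smul_one]
  | add x y _ _ hx hy => rw [map_add, map_add, hx, hy]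
  | mul x y _ _ hx hy =>
    rw [HopfAlgebra.antipode_mul_antidistrib, HopfAlgebra.antipode_mul_antidistrib, hx, hy]
end
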